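/- arXiv:1111.6810 — 3 statements merged into one kernel-verified Lean document; each statement's English description precedes it below -/
import Mathlib

section
/- Let ξ be a real random variable with distribution function F and mean E ξ = −a < 0, and suppose F is long-tailed. Then for any ε > 0 there exists R > 0 such that for all t ≥ R, E[Ĝ_{a+ε}(t − ξ)] ≥ Ĝ_{a+ε}(t). -/
open MeasureTheory ProbabilityTheory Filter Set

noncomputable section

/-- The integrated tail `F̄_s(x) = ∫_x^∞ (1 - F(u)) du` of a distribution function `F`. -/
def tailFs (F : ℝ → ℝ) (x : ℝ) : ℝ := ∫ u in Set.Ioi x, (1 - F u)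

/-- `F` is long-tailed: `F̄(x) > 0` everywhere and `F̄(x+t)/F̄(x) → 1` as `x → ∞`
for every fixed `t`. -/
def LongTailed (F : ℝ → ℝ) : Prop :=
  (∀ x, 0 < 1 - F x) ∧
    ∀ t : ℝ, Tendsto (fun x => (1 - F (x + t)) / (1 - F x)) atTop (nhds 1)

/-- `F` belongs to the class `S*` of strong subexponential distribution functions:
`a₊ = ∫_0^∞ F̄(y) dy ∈ (0,∞)` and `∫_0^x F̄(x-y) F̄(y) dy ∼ 2 a₊ F̄(x)` as `x → ∞`. -/
def StrongSubexp (F : ℝ → ℝ) : Prop :=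
  IntegrableOn (fun y => 1 - F y) (Set.Ioi (0:ℝ)) ∧
  (0 < ∫ y in Set.Ioi (0:ℝ), (1 - F y)) ∧
  Tendsto (fun x => (∫ y in Set.Icc (0:ℝ) x, (1 - F (x - y)) * (1 - F y)) / (1 - F x))
    atTop (nhds (2 * ∫ y in Set.Ioi (0:ℝ), (1 - F y)))

/-- `G_c(x) = F̄_s(x)` for `x ≥ 0` and `G_c(x) = c` for `x < 0`. -/
def Gfun (F : ℝ → ℝ) (c x : ℝ) : ℝ := if 0 ≤ x then tailFs F x else c

/-- `Ĝ_c(x) = min (G_c(x), c)`. -/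
def Ghat (F : ℝ → ℝ) (c x : ℝ) : ℝ := min (Gfun F c x) c

lemma one_sub_eq_measureReal_lt {Ω : Type*} [MeasureSpace Ω] [IsProbabilityMeasure (ℙ : Measure Ω)]
    {ξ : Ω → ℝ} (hmeas : Measurable ξ)
    {F : ℝ → ℝ} (hF : ∀ x, F x = (ℙ {ω | ξ ω ≤ x}).toReal) (x : ℝ) :
    1 - F x = (ℙ : Measure Ω).real {ω | x < ξ ω} := by
  have h := probReal_compl_eq_one_sub (μ := (ℙ : Measure Ω))
    (measurableSet_le hmeas (measurable_const (a := x)))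
  have hs : {ω | ξ ω ≤ x}ᶜ = {ω | x < ξ ω} := by ext; simp
  rw [← hs, h, hF]
  rfl

lemma monotone_of_eq_measure_le {Ω : Type*} [MeasureSpace Ω] [IsProbabilityMeasure (ℙ : Measure Ω)]
    {ξ : Ω → ℝ} {F : ℝ → ℝ} (hF : ∀ x, F x = (ℙ {ω | ξ ω ≤ x}).toReal) : Monotone F := by
  intro x y hxy
  rw [hF, hF]
  exact ENNReal.toReal_mono (measure_ne_top _ _)
    (measure_mono fun ω (hω : ξ ω ≤ x) => hω.trans hxy)

lemma integrableOn_Ioi_one_sub {Ω : Type*} [MeasureSpace Ω] [IsProbabilityMeasure (ℙ : Measure Ω)]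
    {ξ : Ω → ℝ} (hmeas : Measurable ξ) (hint : Integrable ξ ℙ)
    {F : ℝ → ℝ} (hF : ∀ x, F x = (ℙ {ω | ξ ω ≤ x}).toReal) (x : ℝ) :
    IntegrableOn (fun u => 1 - F u) (Ioi x) := by
  have hanti : Antitone (fun u => 1 - F u) := fun u v huv =>
    sub_le_sub_left (monotone_of_eq_measure_le hF huv) 1
  have h0 : IntegrableOn (fun u => 1 - F u) (Ioi 0) := by
    have hpos : Integrable (fun ω => max (ξ ω) 0) ℙ := hint.pos_part
    have hlc := lintegral_eq_lintegral_meas_lt (ℙ : Measure Ω)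
      (f := fun ω => max (ξ ω) 0) (ae_of_all _ fun ω => le_max_right _ _) hpos.aemeasurable
    refine ⟨hanti.measurable.aestronglyMeasurable, ?_⟩
    rw [hasFiniteIntegral_iff_ofReal
      (ae_of_all _ fun u => by
        change 0 ≤ 1 - F u
        rw [one_sub_eq_measureReal_lt hmeas hF]; positivity)]
    have heq : ∫⁻ u in Ioi (0 : ℝ), ENNReal.ofReal (1 - F u)
        = ∫⁻ u in Ioi (0 : ℝ), ℙ {ω | u < max (ξ ω) 0} := by
      refine setLIntegral_congr_fun measurableSet_Ioi fun u hu => ?_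
      have hs : {ω | u < max (ξ ω) 0} = {ω | u < ξ ω} := by
        ext ω
        simp [not_lt.2 (le_of_lt (mem_Ioi.1 hu))]
      simp only [hs]
      rw [one_sub_eq_measureReal_lt hmeas hF, ofReal_measureReal]
    rw [heq, ← hlc]
    exact hpos.lintegral_lt_top
  refine ((hanti.locallyIntegrable.integrableOn_isCompact
    (isCompact_Icc (a := x) (b := 0))).union h0).mono_set fun u hu => ?_
  rcases le_or_gt u 0 with h | h
  · exact Or.inl ⟨le_of_lt hu, h⟩
  · exact Or.inr h

lemma antitone_tailFs {F : ℝ → ℝ} (hpos : ∀ x, 0 < 1 - F x)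
    (hI : ∀ x, IntegrableOn (fun u => 1 - F u) (Ioi x)) : Antitone (tailFs F) := fun x _ hxy =>
  setIntegral_mono_set (hI x) (ae_of_all _ fun u => (hpos u).le)
    (Ioi_subset_Ioi hxy).eventuallyLE

lemma tailFs_nonneg {F : ℝ → ℝ} (hpos : ∀ x, 0 < 1 - F x) (x : ℝ) : 0 ≤ tailFs F x :=
  integral_nonneg fun u => (hpos u).le

lemma tendsto_tailFs {F : ℝ → ℝ} (hI : ∀ x, IntegrableOn (fun u => 1 - F u) (Ioi x)) :
    Tendsto (tailFs F) atTop (nhds 0) := by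
  have h := (intervalIntegral_tendsto_integral_Ioi 0 (hI 0) tendsto_id).const_sub (tailFs F 0)
  have h0 : tailFs F 0 - ∫ u in Ioi 0, (1 - F u) = 0 := sub_self _
  rw [h0] at h
  refine h.congr fun x => ?_
  rw [id, ← intervalIntegral.integral_Ioi_sub_Ioi' (hI 0) (hI x)]
  exact sub_sub_cancel _ _

/-- Convexity of the integrated tail, as a supporting line inequality. -/
lemma tailFs_add_mul_le {F : ℝ → ℝ} (hmono : Monotone F)
    (hI : ∀ x, IntegrableOn (fun u => 1 - F u) (Ioi x)) (t y : ℝ) :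
    tailFs F t + (1 - F t) * y ≤ tailFs F (t - y) := by
  have hanti : Antitone (fun u => 1 - F u) := fun u v huv => sub_le_sub_left (hmono huv) 1
  have hsub : tailFs F (t - y) - tailFs F t = ∫ u in (t - y)..t, (1 - F u) :=
    intervalIntegral.integral_Ioi_sub_Ioi' (hI _) (hI _)
  have hconst : ∫ _ in (t - y)..t, (1 - F t) = (1 - F t) * y := by
    rw [intervalIntegral.integral_const, smul_eq_mul]; ring
  suffices h : ∫ _ in (t - y)..t, (1 - F t) ≤ ∫ u in (t - y)..t, (1 - F u) by linarith
  rcases le_total 0 y with hy | hy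
  · exact intervalIntegral.integral_mono_on (by linarith) intervalIntegrable_const
      hanti.intervalIntegrable fun u hu => hanti hu.2
  · rw [intervalIntegral.integral_symm t, intervalIntegral.integral_symm t, neg_le_neg_iff]
    exact intervalIntegral.integral_mono_on (by linarith) hanti.intervalIntegrable
      intervalIntegrable_const fun u hu => hanti hu.1

lemma measurable_Ghat {F : ℝ → ℝ} (hanti : Antitone (tailFs F)) (c : ℝ) :
    Measurable (Ghat F c) :=
  (Measurable.ite measurableSet_Ici hanti.measurable measurable_const).min measurable_const

lemma Ghat_nonneg {F : ℝ → ℝ} (hpos : ∀ x, 0 < 1 - F x) {c : ℝ} (hc : 0 ≤ c) (x : ℝ) :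
    0 ≤ Ghat F c x := by
  unfold Ghat Gfun
  split_ifs
  · exact le_min (tailFs_nonneg hpos x) hc
  · exact le_min hc hc

/-- A pointwise lower bound for `Ghat F c (t - y)`, beyond a point `b` where the integrated tail
has fallen below `c`. -/
lemma le_Ghat_sub {F : ℝ → ℝ} (hmono : Monotone F) (hpos : ∀ x, 0 < 1 - F x)
    (hI : ∀ x, IntegrableOn (fun u => 1 - F u) (Ioi x)) {b c t : ℝ} (hb : 0 ≤ b)
    (hbc : tailFs F b ≤ c) (hbt : b ≤ t) (y : ℝ) :
    tailFs F t + (1 - F t) * (Iic (t - b)).indicator id y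
      + (c - tailFs F t) * (Ioi t).indicator 1 y ≤ Ghat F c (t - y) := by
  have hanti := antitone_tailFs hpos hI
  rcases lt_or_ge t y with hy | hy
  · have h1 : y ∉ Iic (t - b) := fun h => by rw [mem_Iic] at h; linarith
    have h2 : ¬ 0 ≤ t - y := by linarith
    simp [Ghat, Gfun, h1, h2, hy]
  · have h2 : y ∉ Ioi t := not_lt.2 hy
    have h3 : 0 ≤ t - y := by linarith
    simp only [Ghat, Gfun, if_pos h3, indicator_of_notMem h2, mul_zero, add_zero]
    rcases le_or_gt y (t - b) with hyb | hyb
    · rw [indicator_of_mem (mem_Iic.2 hyb), id]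
      exact (tailFs_add_mul_le hmono hI t y).trans
        (le_min le_rfl ((hanti (by linarith)).trans hbc))
    · rw [indicator_of_notMem (by simpa using hyb), mul_zero, add_zero]
      exact le_min (hanti (by linarith)) ((hanti hbt).trans hbc)

lemma tendsto_integral_indicator_Iic {Ω : Type*} [MeasurableSpace Ω] {μ : Measure Ω}
    {ξ : Ω → ℝ} (hmeas : Measurable ξ) (hint : Integrable ξ μ) :
    Tendsto (fun s : ℝ => ∫ ω, (Iic s).indicator id (ξ ω) ∂μ) atTop (nhds (∫ ω, ξ ω ∂μ)) := by
  refine tendsto_integral_filter_of_dominated_convergence (fun ω => ‖ξ ω‖)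
    (Eventually.of_forall fun s =>
      ((measurable_id.indicator measurableSet_Iic).comp hmeas).aestronglyMeasurable)
    (Eventually.of_forall fun s => ae_of_all _ fun ω => norm_indicator_le_norm_self _ _)
    hint.norm (ae_of_all _ fun ω => tendsto_const_nhds.congr' ?_)
  filter_upwards [eventually_ge_atTop (ξ ω)] with s hs
  rw [indicator_of_mem (mem_Iic.2 hs), id]

theorem stmt9 {Ω : Type*} [MeasureSpace Ω] [IsProbabilityMeasure (ℙ : Measure Ω)]
    (ξ : Ω → ℝ) (hmeas : Measurable ξ)
    (F : ℝ → ℝ) (hF : ∀ x, F x = (ℙ {ω | ξ ω ≤ x}).toReal)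
    (a : ℝ) (ha : 0 < a) (hint : Integrable ξ ℙ)
    (hmean : ∫ ω, ξ ω ∂ℙ = -a)
    (hlong : LongTailed F) :
    ∀ ε > 0, ∃ R > 0, ∀ t ≥ R,
      Ghat F (a + ε) t ≤ ∫ ω, Ghat F (a + ε) (t - ξ ω) ∂ℙ := by
  intro ε hε
  have hpos := hlong.1
  have hmono := monotone_of_eq_measure_le hF
  have hI := integrableOn_Ioi_one_sub hmeas hint hF
  have hanti := antitone_tailFs hpos hI
  have hc : 0 < a + ε := by linarith
  have htail := tendsto_tailFs hI
  obtain ⟨b, hbc, hb⟩ :=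
    ((htail.eventually (ge_mem_nhds hc)).and (eventually_ge_atTop 0)).exists
  have hmean_trunc := tendsto_integral_indicator_Iic hmeas hint
  rw [hmean] at hmean_trunc
  have hmean_shift := hmean_trunc.comp (tendsto_atTop_add_const_right atTop (-b) tendsto_id)
  obtain ⟨R, hR⟩ := eventually_atTop.1
    ((hmean_shift.eventually (lt_mem_nhds (show -a - ε / 2 < -a by linarith))).and
      (htail.eventually (gt_mem_nhds (half_pos hε))))
  refine ⟨max R (b + 1), lt_max_of_lt_right (by linarith), fun t ht => ?_⟩
  obtain ⟨h1, h2⟩ := hR t ((le_max_left _ _).trans ht)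
  have hbt : b ≤ t := by linarith [(le_max_right R (b + 1)).trans ht]
  simp only [Function.comp_apply, id, ← sub_eq_add_neg] at h1
  have hint1 : Integrable (fun ω => (Iic (t - b)).indicator id (ξ ω)) ℙ :=
    hint.mono ((measurable_id.indicator measurableSet_Iic).comp hmeas).aestronglyMeasurable
      (ae_of_all _ fun ω => norm_indicator_le_norm_self _ _)
  have hset : MeasurableSet {ω | t < ξ ω} := measurableSet_lt measurable_const hmeas
  have hind : (fun ω => (Ioi t).indicator (1 : ℝ → ℝ) (ξ ω))
      = {ω | t < ξ ω}.indicator (1 : Ω → ℝ) := rfl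
  have hint2 : Integrable (fun ω => (Ioi t).indicator (1 : ℝ → ℝ) (ξ ω)) ℙ := by
    rw [hind]
    exact (integrable_const (1 : ℝ)).indicator hset
  have hint3 : Integrable (fun ω => Ghat F (a + ε) (t - ξ ω)) ℙ := by
    refine Integrable.of_bound ((measurable_Ghat hanti _).comp
      (measurable_const.sub hmeas)).aestronglyMeasurable (a + ε) (ae_of_all _ fun ω => ?_)
    rw [Real.norm_of_nonneg (Ghat_nonneg hpos hc.le _)]
    exact min_le_right _ _
  have hle := integral_mono
    (((integrable_const (tailFs F t)).add (hint1.const_mul (1 - F t))).add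
      (hint2.const_mul (a + ε - tailFs F t))) hint3
    fun ω => le_Ghat_sub hmono hpos hI hb hbc hbt (ξ ω)
  have hval : Ghat F (a + ε) t ≤ tailFs F t := by
    simp [Ghat, Gfun, hb.trans hbt]
  refine hval.trans (le_trans ?_ hle)
  rw [integral_add' ((integrable_const _).add (hint1.const_mul _)) (hint2.const_mul _),
    integral_add' (integrable_const _) (hint1.const_mul _), integral_const_mul,
    integral_const_mul, hind, integral_indicator_one hset,
    ← one_sub_eq_measureReal_lt hmeas hF, integral_const, probReal_univ, one_smul]
  change _ < ∫ ω, (Iic (t - b)).indicator id (ξ ω) at h1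
  nlinarith [mul_nonneg (hpos t).le (show 0 ≤ (∫ ω, (Iic (t - b)).indicator id (ξ ω))
    + (a + ε - tailFs F t) by linarith)]
end
end

section
/- Let ξ be a real random variable with distribution function F and mean E ξ = −a < 0, and suppose F belongs to the class S*. Then for any ε with 0 < ε < a there exists R > 0 such that for all t ≥ R, E[G_{a−ε}(t − ξ)] ≤ G_{a−ε}(t). -/
open MeasureTheory ProbabilityTheory Filter Set

noncomputable section

/-- Splitting the convolution of an antitone `T` with itself at its midpoint and at `N`. -/
theorem Antitone.le_self_convolution {T : ℝ → ℝ} (hT : Antitone T) (hpos : ∀ x, 0 ≤ T x)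
    {N x : ℝ} (hN : 0 ≤ N) (hx : 2 * N ≤ x) :
    2 * (T x * (∫ u in (0 : ℝ)..N, T u) + T (x - N) * ∫ u in N..(x / 2), T u) ≤
      ∫ y in Icc (0 : ℝ) x, T (x - y) * T y := by
  have hTi : ∀ p q : ℝ, IntervalIntegrable T volume p q := fun p q => hT.intervalIntegrable
  have hTm : Monotone fun y => T (x - y) := fun y z h => hT (by linarith)
  have hprod : ∀ p q : ℝ, IntervalIntegrable (fun y => T (x - y) * T y) volume p q := by
    intro p q
    rw [intervalIntegrable_iff]
    refine (intervalIntegrable_iff.1 (hTi p q)).bdd_mul (c := T (x - max p q))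
      hTm.measurable.aestronglyMeasurable ?_
    filter_upwards [ae_restrict_mem measurableSet_uIoc] with y hy
    rw [Real.norm_of_nonneg (hpos _)]
    exact hT (by linarith [hy.2])
  have hsymm : ∫ y in (x / 2)..x, T (x - y) * T y = ∫ y in (0 : ℝ)..(x / 2), T (x - y) * T y := by
    have h := intervalIntegral.integral_comp_sub_left (a := 0) (b := x / 2)
      (fun y => T (x - y) * T y) x
    rw [sub_zero, show x - x / 2 = x / 2 by ring] at h
    rw [← h]
    simp [mul_comm]
  rw [integral_Icc_eq_integral_Ioc, ← intervalIntegral.integral_of_le (by linarith),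
    ← intervalIntegral.integral_add_adjacent_intervals (hprod 0 (x / 2)) (hprod (x / 2) x), hsymm,
    ← intervalIntegral.integral_add_adjacent_intervals (hprod 0 N) (hprod N (x / 2))]
  have h1 : T x * (∫ u in (0 : ℝ)..N, T u) ≤ ∫ y in (0 : ℝ)..N, T (x - y) * T y := by
    rw [← intervalIntegral.integral_const_mul]
    refine intervalIntegral.integral_mono_on hN ((hTi _ _).const_mul _) (hprod _ _) fun y hy => ?_
    exact mul_le_mul_of_nonneg_right (hT (by linarith [hy.1])) (hpos y)
  have h2 : T (x - N) * (∫ u in N..(x / 2), T u) ≤ ∫ y in N..(x / 2), T (x - y) * T y := by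
    rw [← intervalIntegral.integral_const_mul]
    refine intervalIntegral.integral_mono_on (by linarith) ((hTi _ _).const_mul _) (hprod _ _)
      fun y hy => ?_
    exact mul_le_mul_of_nonneg_right (hT (by linarith [hy.1])) (hpos y)
  linarith

/-- A tail satisfying the defining asymptotics of `S*` is long-tailed. -/
theorem Antitone.tendsto_shift_ratio {T : ℝ → ℝ} (hT : Antitone T) (hpos : ∀ x, 0 < T x)
    (hi : IntegrableOn T (Ioi 0))
    (hconv : Tendsto (fun x => (∫ y in Icc (0 : ℝ) x, T (x - y) * T y) / T x) atTop
      (nhds (2 * ∫ y in Ioi (0 : ℝ), T y))) {N : ℝ} (hN : 0 ≤ N) :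
    Tendsto (fun x => T (x + N) / T x) atTop (nhds 1) := by
  have hiN : IntegrableOn T (Ioi N) := hi.mono_set (Ioi_subset_Ioi hN)
  have hsplit : (∫ u in (0 : ℝ)..N, T u) + ∫ u in Ioi N, T u = ∫ u in Ioi (0 : ℝ), T u :=
    intervalIntegral.integral_interval_add_Ioi hi hiN
  have hBpos : 0 < ∫ u in Ioi N, T u := by
    have hI : 0 < ∫ u in N..(N + 1), T u :=
      intervalIntegral.intervalIntegral_pos_of_pos hT.intervalIntegrable hpos (by linarith)
    have hadd := intervalIntegral.integral_interval_add_Ioi hiN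
      (hi.mono_set (Ioi_subset_Ioi (by linarith : (0 : ℝ) ≤ N + 1)))
    have hge : 0 ≤ ∫ u in Ioi (N + 1), T u := integral_nonneg fun u => (hpos u).le
    linarith
  have hhalf : Tendsto (fun x : ℝ => ∫ u in N..(x / 2), T u) atTop (nhds (∫ u in Ioi N, T u)) :=
    intervalIntegral_tendsto_integral_Ioi N hiN (tendsto_id.atTop_div_const two_pos)
  have hupper : Tendsto (fun x => ((∫ y in Icc (0 : ℝ) x, T (x - y) * T y) / T x / 2 -
      ∫ u in (0 : ℝ)..N, T u) / ∫ u in N..(x / 2), T u) atTop (nhds 1) := by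
    have h := ((hconv.div_const 2).sub_const (∫ u in (0 : ℝ)..N, T u)).div hhalf hBpos.ne'
    have hone : (2 * (∫ y in Ioi (0 : ℝ), T y) / 2 - ∫ u in (0 : ℝ)..N, T u) /
        ∫ u in Ioi N, T u = 1 := by
      rw [div_eq_one_iff_eq hBpos.ne']
      linarith
    rwa [hone] at h
  have hratio : Tendsto (fun x => T (x - N) / T x) atTop (nhds 1) := by
    refine tendsto_of_tendsto_of_tendsto_of_le_of_le' tendsto_const_nhds hupper
      (Eventually.of_forall fun x => ?_) ?_
    · exact (one_le_div (hpos x)).2 (hT (by linarith))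
    · filter_upwards [eventually_ge_atTop (2 * N), hhalf.eventually_const_lt hBpos] with x hx hxB
      have h := hT.le_self_convolution (fun y => (hpos y).le) hN hx
      rw [le_div_iff₀ hxB, le_sub_iff_add_le, div_div, le_div_iff₀ (mul_pos (hpos x) two_pos)]
      have := hpos x
      calc _ = 2 * (T x * (∫ u in (0 : ℝ)..N, T u) + T (x - N) * ∫ u in N..(x / 2), T u) := by
            field_simp
            ring
        _ ≤ _ := h
  have h := (hratio.comp (tendsto_atTop_add_const_right atTop N tendsto_id)).inv₀ one_ne_zero
  simpa [Function.comp_def, inv_div] using h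

section Tail

variable {Ω : Type*} [MeasurableSpace Ω] {μ : Measure Ω} {ξ : Ω → ℝ}

/-- The mean of the positive part is the integral of the tail. -/
theorem integral_Ioi_tail_eq (hint : Integrable ξ μ) :
    ∫ u in Ioi (0 : ℝ), μ.real {ω | u < ξ ω} = ∫ ω, max (ξ ω) 0 ∂μ := by
  rw [hint.pos_part.integral_eq_integral_meas_lt (Eventually.of_forall fun ω => le_max_right _ _)]
  refine setIntegral_congr_fun measurableSet_Ioi fun u hu => ?_
  have hu' : ¬ u < 0 := not_lt.2 (le_of_lt hu)
  simp [hu']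

/-- The truncated means of the negative part approach its mean. -/
theorem tendsto_integral_min_negPart (hint : Integrable ξ μ) :
    Tendsto (fun n : ℕ => ∫ ω, min (max (-ξ ω) 0) n ∂μ) atTop
      (nhds (∫ ω, max (-ξ ω) 0 ∂μ)) := by
  have hneg : Integrable (fun ω => max (-ξ ω) 0) μ := hint.neg.pos_part
  refine tendsto_integral_of_dominated_convergence _
    (fun n => (hneg.aestronglyMeasurable.inf aestronglyMeasurable_const)) hneg ?_ ?_
  · refine fun n => Eventually.of_forall fun ω => ?_
    rw [Real.norm_of_nonneg (le_min (le_max_right _ _) n.cast_nonneg)]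
    exact min_le_left _ _
  · refine Eventually.of_forall fun ω => tendsto_const_nhds.congr' ?_
    filter_upwards [eventually_ge_atTop ⌈max (-ξ ω) 0⌉₊] with n hn
    exact (min_eq_left (Nat.ceil_le.1 hn)).symm

/-- Fubini for the overshoot term. -/
theorem integral_overshoot [IsProbabilityMeasure μ] (hmeas : Measurable ξ) {T : ℝ → ℝ}
    (hT : ∀ x, T x = μ.real {ω | x < ξ ω}) {t : ℝ} (ht : 0 ≤ t) :
    Integrable (fun ω => ∫ u in Ioc (0 : ℝ) t,
        T u * {ω | t - u < ξ ω ∧ ξ ω ≤ t}.indicator 1 ω) μ ∧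
      ∫ ω, (∫ u in Ioc (0 : ℝ) t, T u * {ω | t - u < ξ ω ∧ ξ ω ≤ t}.indicator 1 ω) ∂μ =
        (∫ y in Icc (0 : ℝ) t, T (t - y) * T y) - T t * ∫ u in (0 : ℝ)..t, T u := by
  have hanti : Antitone T := fun x y h => by
    rw [hT, hT]
    exact measureReal_mono fun ω hω => lt_of_le_of_lt h hω
  have hpos : ∀ x, 0 ≤ T x := fun x => by rw [hT]; exact measureReal_nonneg
  have hle : ∀ x, T x ≤ 1 := fun x => by rw [hT]; exact measureReal_le_one
  have hS : MeasurableSet {p : Ω × ℝ | t - p.2 < ξ p.1 ∧ ξ p.1 ≤ t} :=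
    (measurableSet_lt (f := fun p : Ω × ℝ => t - p.2) (g := fun p => ξ p.1)
      (by fun_prop) (by fun_prop)).inter
      (measurableSet_le (f := fun p : Ω × ℝ => ξ p.1) (g := fun _ => t) (by fun_prop) (by fun_prop))
  have hSu : ∀ u, MeasurableSet {ω | t - u < ξ ω ∧ ξ ω ≤ t} := fun u =>
    (measurableSet_lt measurable_const hmeas).inter (measurableSet_le hmeas measurable_const)
  have hprod : Integrable (Function.uncurry fun ω u =>
      T u * {ω | t - u < ξ ω ∧ ξ ω ≤ t}.indicator (1 : Ω → ℝ) ω)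
      (μ.prod (volume.restrict (Ioc (0 : ℝ) t))) := by
    have heq : (Function.uncurry fun ω u =>
        T u * {ω | t - u < ξ ω ∧ ξ ω ≤ t}.indicator (1 : Ω → ℝ) ω) =
        fun p : Ω × ℝ => T p.2 *
          {p : Ω × ℝ | t - p.2 < ξ p.1 ∧ ξ p.1 ≤ t}.indicator (1 : Ω × ℝ → ℝ) p := by
      ext p
      simp [Function.uncurry, indicator]
    rw [heq]
    refine Integrable.of_bound (C := 1) ((hanti.measurable.comp measurable_snd).mul
      (measurable_one.indicator hS)).aestronglyMeasurable (Eventually.of_forall fun p => ?_)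
    rw [norm_mul, Real.norm_of_nonneg (hpos _)]
    refine mul_le_one₀ (hle _) (norm_nonneg _) ?_
    exact (norm_indicator_le_norm_self _ _).trans (by simp)
  refine ⟨hprod.integral_prod_left, ?_⟩
  rw [integral_integral_swap hprod]
  have hinner : ∀ u ∈ Ioc (0 : ℝ) t,
      ∫ ω, T u * {ω | t - u < ξ ω ∧ ξ ω ≤ t}.indicator (1 : Ω → ℝ) ω ∂μ =
        T (t - u) * T u - T t * T u := by
    intro u hu
    rw [integral_const_mul, integral_indicator_one (hSu u)]
    have hdiff : {ω | t - u < ξ ω ∧ ξ ω ≤ t} = {ω | t - u < ξ ω} \ {ω | t < ξ ω} := by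
      ext ω
      simp
    have hsubset : {ω | t < ξ ω} ⊆ {ω | t - u < ξ ω} := fun ω hω =>
      lt_trans (by linarith [hu.1] : t - u < t) hω
    rw [hdiff, measureReal_sdiff hsubset
      (measurableSet_lt measurable_const hmeas), ← hT, ← hT]
    ring
  rw [setIntegral_congr_fun measurableSet_Ioc hinner, integral_Icc_eq_integral_Ioc,
    intervalIntegral.integral_of_le ht, ← integral_const_mul, integral_sub]
  · refine Integrable.of_bound (C := 1) (((hanti.measurable.comp
      (measurable_const.sub measurable_id)).mul hanti.measurable).aestronglyMeasurable)
      (Eventually.of_forall fun u => ?_)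
    rw [norm_mul, Real.norm_of_nonneg (hpos _), Real.norm_of_nonneg (hpos _)]
    exact mul_le_one₀ (hle _) (hpos _) (hle _)
  · exact ((hanti.intervalIntegrable (a := 0) (b := t)).1).const_mul _

end Tail

/-- Pointwise bound for `G_c(t - x)` around `F̄_s(t)`. -/
theorem Gfun_sub_le {F : ℝ → ℝ} (hanti : Antitone fun u => 1 - F u) (hpos : ∀ u, 0 ≤ 1 - F u)
    (hi : IntegrableOn (fun u => 1 - F u) (Ioi 0)) (c : ℝ) {t N : ℝ} (ht : 0 ≤ t) (hN : 0 ≤ N)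
    (x : ℝ) :
    Gfun F c (t - x) ≤ tailFs F t + (Ioi t).indicator (fun _ => c) x +
      (∫ u in Ioc (0 : ℝ) t, (1 - F u) * {x | t - u < x ∧ x ≤ t}.indicator 1 x) -
      (1 - F (t + N)) * min (max (-x) 0) N := by
  have hInt : ∀ p q : ℝ, IntervalIntegrable (fun u => 1 - F u) volume p q :=
    fun p q => hanti.intervalIntegrable
  have htail : ∀ y, 0 ≤ y → tailFs F y = tailFs F t + ∫ u in y..t, (1 - F u) := by
    intro y hy
    have := intervalIntegral.integral_interval_add_Ioi (hi.mono_set (Ioi_subset_Ioi hy))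
      (hi.mono_set (Ioi_subset_Ioi ht))
    simp only [tailFs]
    linarith
  have hover : 0 ≤ ∫ u in Ioc (0 : ℝ) t, (1 - F u) * {x | t - u < x ∧ x ≤ t}.indicator 1 x :=
    integral_nonneg fun u => mul_nonneg (hpos u) (indicator_nonneg (by simp) _)
  rcases lt_or_ge t x with hx | hx
  · have hG : Gfun F c (t - x) = c := if_neg (by linarith)
    have h0 : 0 ≤ tailFs F t := integral_nonneg fun u => hpos u
    rw [hG, indicator_of_mem (show x ∈ Ioi t from hx), max_eq_right (by linarith), min_eq_left hN]
    linarith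
  have hG : Gfun F c (t - x) = tailFs F (t - x) := if_pos (by linarith)
  rw [hG, htail _ (by linarith), indicator_of_notMem (show x ∉ Ioi t from not_lt.2 hx)]
  rcases le_or_gt 0 x with h0 | h0
  · rw [max_eq_right (by linarith : -x ≤ 0), min_eq_left hN]
    have heq : ∫ u in Ioc (0 : ℝ) t, (1 - F u) * {x | t - u < x ∧ x ≤ t}.indicator 1 x =
        ∫ u in (t - x)..t, (1 - F u) := by
      rw [intervalIntegral.integral_of_le (by linarith),
        ← integral_indicator measurableSet_Ioc, ← integral_indicator measurableSet_Ioc]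
      congr 1
      ext u
      have hiff : t - u < x ↔ t - x < u := by constructor <;> intro h <;> linarith
      by_cases hu : t - x < u
      · have : 0 < u := by linarith
        simp [indicator, hiff, hu, hx, this]
      · simp [indicator, hiff, hu]
    rw [heq]
    linarith
  · rw [max_eq_left (by linarith : 0 ≤ -x), intervalIntegral.integral_symm]
    set m := min (-x) N
    have hm0 : 0 ≤ m := le_min (by linarith) hN
    have hmx : m ≤ -x := min_le_left _ _
    have hmN : m ≤ N := min_le_right _ _
    have hlow : (1 - F (t + N)) * m ≤ ∫ u in t..(t + m), (1 - F u) := by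
      calc (1 - F (t + N)) * m = ∫ _ in t..(t + m), (1 - F (t + N)) := by
            rw [intervalIntegral.integral_const, smul_eq_mul]
            ring
        _ ≤ _ := intervalIntegral.integral_mono_on (by linarith) (by simp) (hInt _ _)
            fun u hu => hanti (by linarith [hu.2])
    have hext : ∫ u in t..(t + m), (1 - F u) ≤ ∫ u in t..(t - x), (1 - F u) :=
      intervalIntegral.integral_mono_interval le_rfl (by linarith) (by linarith)
        (Eventually.of_forall fun u => hpos u) (hInt _ _)
    linarith

theorem stmt10 {Ω : Type*} [MeasureSpace Ω] [IsProbabilityMeasure (ℙ : Measure Ω)]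
    (ξ : Ω → ℝ) (hmeas : Measurable ξ)
    (F : ℝ → ℝ) (hF : ∀ x, F x = (ℙ {ω | ξ ω ≤ x}).toReal)
    (a : ℝ) (ha : 0 < a) (hint : Integrable ξ ℙ)
    (hmean : ∫ ω, ξ ω ∂ℙ = -a)
    (hsub : StrongSubexp F) :
    ∀ ε, 0 < ε → ε < a → ∃ R > 0, ∀ t ≥ R,
      ∫ ω, Gfun F (a - ε) (t - ξ ω) ∂ℙ ≤ Gfun F (a - ε) t := by
  intro ε hε hεa
  obtain ⟨hi, hApos, hconv⟩ := hsub
  have hT : ∀ x, 1 - F x = (ℙ : Measure Ω).real {ω | x < ξ ω} := by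
    intro x
    have h := probReal_compl_eq_one_sub (μ := (ℙ : Measure Ω))
      (measurableSet_le hmeas (measurable_const (a := x)))
    rw [hF x]
    rw [show {ω | x < ξ ω} = {ω | ξ ω ≤ x}ᶜ by ext ω; simp]
    exact h.symm
  have hanti : Antitone fun x => 1 - F x := fun x y h => by
    simp only [hT]
    exact measureReal_mono fun ω hω => lt_of_le_of_lt h hω
  have hnn : ∀ x, 0 ≤ 1 - F x := fun x => by rw [hT]; exact measureReal_nonneg
  have hpos : ∀ x, 0 < 1 - F x := by
    intro x
    have hev := hconv.eventually_ne (by positivity : 2 * ∫ y in Ioi (0 : ℝ), (1 - F y) ≠ 0)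
    obtain ⟨y, hy, hxy⟩ := (hev.and (eventually_ge_atTop x)).exists
    have hy0 : 1 - F y ≠ 0 := fun h => hy (by rw [h, div_zero])
    exact ((hnn y).lt_of_ne' hy0).trans_le (hanti hxy)
  set A := ∫ y in Ioi (0 : ℝ), (1 - F y) with hA
  set B := ∫ ω, max (-ξ ω) 0 ∂(ℙ : Measure Ω)
  have hAB : A - B = -a := by
    have hA' : A = ∫ ω, max (ξ ω) 0 ∂(ℙ : Measure Ω) := by
      rw [← integral_Ioi_tail_eq hint, hA]
      simp only [hT]
    have hneg : Integrable (fun ω => max (-ξ ω) 0) (ℙ : Measure Ω) := hint.neg.pos_part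
    rw [hA', ← hmean, ← integral_sub hint.pos_part hneg]
    refine integral_congr_ae (Eventually.of_forall fun ω => ?_)
    rcases le_total (ξ ω) 0 with h | h <;> simp [h]
  obtain ⟨n, hn⟩ := ((tendsto_integral_min_negPart hint).eventually_const_lt
    (by linarith : B - ε / 4 < B)).exists
  set m := ∫ ω, min (max (-ξ ω) 0) (n : ℝ) ∂(ℙ : Measure Ω)
  have hshift := (hanti.tendsto_shift_ratio hpos hi hconv n.cast_nonneg).mul_const m
  rw [one_mul] at hshift
  have hpart : Tendsto (fun t : ℝ => ∫ u in (0 : ℝ)..t, (1 - F u)) atTop (nhds A) :=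
    intervalIntegral_tendsto_integral_Ioi 0 hi tendsto_id
  obtain ⟨R, hR⟩ := eventually_atTop.1 (((hshift.eventually_const_lt
    (by linarith : m - ε / 4 < m)).and (hpart.eventually_const_lt
    (by linarith : A - ε / 4 < A))).and (hconv.eventually_lt_const
    (by linarith : 2 * A < 2 * A + ε / 4)))
  refine ⟨max R 1, by positivity, fun t ht => ?_⟩
  obtain ⟨⟨h1, h2⟩, h3⟩ := hR t ((le_max_left _ _).trans ht)
  have ht0 : 0 ≤ t := zero_le_one.trans ((le_max_right _ _).trans ht)
  obtain ⟨hoi, hoe⟩ := integral_overshoot hmeas hT ht0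
  have htp := hpos t
  have hGt : Gfun F (a - ε) t = tailFs F t := if_pos ht0
  have hmin : Integrable (fun ω => min (max (-ξ ω) 0) (n : ℝ)) (ℙ : Measure Ω) :=
    hint.neg.pos_part.inf (integrable_const _)
  have hSt : MeasurableSet {ω | t < ξ ω} := measurableSet_lt measurable_const hmeas
  have hind : Integrable ({ω | t < ξ ω}.indicator fun _ => a - ε) (ℙ : Measure Ω) :=
    (integrable_const _).indicator hSt
  have h₁ : Integrable (fun ω => tailFs F t + {ω | t < ξ ω}.indicator (fun _ => a - ε) ω)
      (ℙ : Measure Ω) := (integrable_const _).add hind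
  have h₂ : Integrable (fun ω => tailFs F t + {ω | t < ξ ω}.indicator (fun _ => a - ε) ω +
      ∫ u in Ioc (0 : ℝ) t, (1 - F u) * {ω | t - u < ξ ω ∧ ξ ω ≤ t}.indicator 1 ω)
      (ℙ : Measure Ω) := h₁.add hoi
  have hbound := integral_mono_of_nonneg (μ := (ℙ : Measure Ω))
    (f := fun ω => Gfun F (a - ε) (t - ξ ω))
    (g := fun ω => tailFs F t + {ω | t < ξ ω}.indicator (fun _ => a - ε) ω +
      (∫ u in Ioc (0 : ℝ) t, (1 - F u) * {ω | t - u < ξ ω ∧ ξ ω ≤ t}.indicator 1 ω) -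
      (1 - F (t + n)) * min (max (-ξ ω) 0) n)
    (Eventually.of_forall fun ω => by
      simp only [Gfun, Pi.zero_apply]
      split_ifs
      · exact integral_nonneg fun u => hnn u
      · linarith)
    (h₂.sub (hmin.const_mul _))
    (Eventually.of_forall fun ω => Gfun_sub_le hanti hnn hi _ ht0 n.cast_nonneg (ξ ω))
  rw [integral_sub h₂ (hmin.const_mul _), integral_add h₁ hoi,
    integral_add (integrable_const _) hind, hoe,
    integral_const_mul, integral_indicator_const _ hSt, ← hT t] at hbound
  simp only [integral_const, probReal_univ, smul_eq_mul] at hbound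
  rw [hGt]
  refine hbound.trans ?_
  rw [div_mul_eq_mul_div, lt_div_iff₀ htp] at h1
  rw [div_lt_iff₀ htp] at h3
  nlinarith [mul_lt_mul_of_pos_left h2 htp, mul_lt_mul_of_pos_left hn htp]
end
end

section
/- Let F be a long-tailed distribution function on ℝ with ∫_{−∞}^0 F(z) dz =: a₋ < ∞. Then lim_{t→∞} (1/F̄(t)) ∫_{−∞}^0 F̄(t − z) F(z) dz = a₋. -/
open MeasureTheory ProbabilityTheory Filter Set

noncomputable section

theorem stmt12
    (F : ℝ → ℝ) (hmono : Monotone F)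
    (hrc : ∀ x, ContinuousWithinAt F (Set.Ici x) x)
    (hbot : Tendsto F atBot (nhds 0)) (htop : Tendsto F atTop (nhds 1))
    (hlong : LongTailed F)
    (hInt : IntegrableOn F (Set.Iic (0:ℝ))) :
    Tendsto (fun t => (∫ z in Set.Iic (0:ℝ), (1 - F (t - z)) * F z) / (1 - F t))
      atTop (nhds (∫ z in Set.Iic (0:ℝ), F z)) := by
  obtain ⟨hpos, hlim⟩ := hlong
  have hF0 : ∀ x, 0 ≤ F x := fun x => hmono.le_of_tendsto hbot x
  simp_rw [← integral_div]
  refine tendsto_integral_filter_of_dominated_convergence F ?_ ?_ hInt ?_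
  · refine Eventually.of_forall fun t => Measurable.aestronglyMeasurable ?_
    have hF : Measurable F := hmono.measurable
    fun_prop
  · refine Eventually.of_forall fun t => ?_
    filter_upwards [ae_restrict_mem measurableSet_Iic] with z hz
    have hle : 1 - F (t - z) ≤ 1 - F t :=
      sub_le_sub_left (hmono (le_sub_self_iff t |>.2 hz)) 1
    rw [Real.norm_of_nonneg
      (div_nonneg (mul_nonneg (hpos _).le (hF0 z)) (hpos t).le), div_le_iff₀ (hpos t), mul_comm]
    exact mul_le_mul_of_nonneg_left hle (hF0 z)
  · refine Eventually.of_forall fun z => ?_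
    simpa [sub_eq_add_neg, div_mul_eq_mul_div] using (hlim (-z)).mul_const (F z)
end
end
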